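/- arXiv:2009.04632 — 7 statements merged into one kernel-verified Lean document; each statement's English description precedes it below -/
import Mathlib

section
/- Let l₁, l₂ ∈ {1,…,c} and let e_{l₁}, e_{l₂} ∈ ℝ^c be the corresponding standard basis vectors. Then e_{l₂} − e_{l₁} ∈ K if and only if l₁ ≤ l₂. -/
open Matrix

/-- The matrix `B` with `-1` on the diagonal, `1` on the first subdiagonal and `0` elsewhere. -/
def matB (c : ℕ) : Matrix (Fin c) (Fin c) ℝ :=
  fun i j => if i = j then -1 else if (i : ℕ) = (j : ℕ) + 1 then 1 else 0

/-- The cone `K = {B y : y ≥ 0}`. -/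
def coneK (c : ℕ) : Set (Fin c → ℝ) :=
  {v | ∃ y : Fin c → ℝ, (∀ k, 0 ≤ y k) ∧ v = (matB c) *ᵥ y}

lemma row_zero (c : ℕ) (y : Fin c → ℝ) (h : 0 < c) :
    ((matB c) *ᵥ y) ⟨0, h⟩ = - y ⟨0, h⟩ := by
  simp only [Matrix.mulVec, dotProduct, matB]
  rw [Finset.sum_eq_single ⟨0, h⟩]
  · simp
  · intro b _ hb
    simp [hb.symm]
  · simp

lemma row_succ (c : ℕ) (y : Fin c → ℝ) (n : ℕ) (h : n + 1 < c) :
    ((matB c) *ᵥ y) ⟨n + 1, h⟩ = y ⟨n, by omega⟩ - y ⟨n + 1, h⟩ := by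
  have key : ∀ j : Fin c, matB c ⟨n + 1, h⟩ j * y j =
      (if (⟨n, by omega⟩ : Fin c) = j then y j else 0)
        - (if (⟨n + 1, h⟩ : Fin c) = j then y j else 0) := by
    intro j
    simp only [matB, Fin.ext_iff]
    split_ifs <;> first | omega | simp
  simp only [Matrix.mulVec, dotProduct, key, Finset.sum_sub_distrib]
  simp

/-- For standard basis vectors, `e_{l₂} - e_{l₁} ∈ K` iff `l₁ ≤ l₂`. -/
theorem stmt_2 (c : ℕ) (hc : 1 ≤ c) (l₁ l₂ : Fin c) :
    (Pi.single l₂ 1 - Pi.single l₁ 1 : Fin c → ℝ) ∈ coneK c ↔ l₁ ≤ l₂ := by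
  constructor
  · rintro ⟨y, hy, hv⟩
    by_contra hlt
    rw [not_le, Fin.lt_def] at hlt
    have main : ∀ n (hn : n < c), n ≤ (l₂ : ℕ) →
        y ⟨n, hn⟩ = if n = (l₂ : ℕ) then -1 else 0 := by
      intro n
      induction n with
      | zero =>
        intro hn hle
        have h := congrFun hv ⟨0, hn⟩
        rw [row_zero] at h
        simp only [Pi.sub_apply, Pi.single_apply, Fin.ext_iff] at h
        rw [if_neg (show ¬ (0 = (l₁ : ℕ)) by omega)] at h
        split_ifs at h ⊢ <;> linarith
      | succ n ih =>
        intro hn hle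
        have h := congrFun hv ⟨n + 1, hn⟩
        rw [row_succ, ih (by omega) (by omega), if_neg (by omega)] at h
        simp only [Pi.sub_apply, Pi.single_apply, Fin.ext_iff] at h
        rw [if_neg (show ¬ (n + 1 = (l₁ : ℕ)) by omega)] at h
        split_ifs at h ⊢ <;> linarith
    have h1 := main l₂ l₂.2 le_rfl
    have h2 := hy l₂
    simp only [if_true, Fin.eta] at h1
    linarith
  · intro hle
    rw [Fin.le_def] at hle
    refine ⟨fun k => if (l₁ : ℕ) ≤ k ∧ (k : ℕ) < l₂ then 1 else 0, ?_, ?_⟩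
    · intro k
      dsimp only
      split_ifs <;> norm_num
    · funext i
      obtain ⟨n, hn⟩ := i
      cases n with
      | zero =>
        rw [row_zero]
        simp only [Pi.sub_apply, Pi.single_apply, Fin.ext_iff]
        split_ifs <;> first | omega | norm_num
      | succ n =>
        rw [row_succ]
        simp only [Pi.sub_apply, Pi.single_apply, Fin.ext_iff]
        split_ifs <;> first | omega | norm_num
end

section
/- Let M ∈ ℝ^{c×c} be an upper triangular matrix (M_{ij} = 0 for i > j) whose strictly upper triangular entries are nonnegative (M_{ij} ≥ 0 for i < j) and whose row sums and column sums are all nonnegative (M𝟙 ≥ 0 and Mᵀ𝟙 ≥ 0 entrywise). Then there exists a matrix M¹ ∈ ℝ^{c×c} which is upper triangular, has the same row sums and column sums as M (M¹𝟙 = M𝟙 and (M¹)ᵀ𝟙 = Mᵀ𝟙), and has all entries nonnegative. -/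
open Matrix

/-- One step: make the diagonal entry `k` nonnegative by a rank-one update. -/
lemma stmt_5_step {c : ℕ} (M : Matrix (Fin c) (Fin c) ℝ) (k : Fin c)
    (hupper : ∀ i j : Fin c, j < i → M i j = 0)
    (hstrict : ∀ i j : Fin c, i < j → 0 ≤ M i j)
    (hrow : ∀ i, 0 ≤ ∑ j, M i j) (hcol : ∀ j, 0 ≤ ∑ i, M i j) (hk : M k k < 0) :
    ∃ N : Matrix (Fin c) (Fin c) ℝ,
      (∀ i j : Fin c, j < i → N i j = 0) ∧ (∀ i j : Fin c, i < j → 0 ≤ N i j) ∧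
      (∀ i, ∑ j, N i j = ∑ j, M i j) ∧ (∀ j, ∑ i, N i j = ∑ i, M i j) ∧
      N k k = 0 ∧ (∀ i, i ≠ k → N i i = M i i) := by
  set A : ℝ := ∑ i, if i < k then M i k else 0 with hA
  set B : ℝ := ∑ j, if k < j then M k j else 0 with hB
  have hA1 : ∑ i, M i k = A + M k k := by
    have : M k k = ∑ i, if i = k then M k k else 0 := by simp
    rw [this, hA, ← Finset.sum_add_distrib]
    refine Finset.sum_congr rfl fun i _ => ?_
    rcases lt_trichotomy i k with h | h | h
    · simp [h, h.ne]
    · subst h; simp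
    · simp [h.not_gt, h.ne', hupper i k h]
  have hB1 : ∑ j, M k j = B + M k k := by
    have : M k k = ∑ i, if i = k then M k k else 0 := by simp
    rw [this, hB, ← Finset.sum_add_distrib]
    refine Finset.sum_congr rfl fun i _ => ?_
    rcases lt_trichotomy i k with h | h | h
    · simp [h.not_gt, h.ne, hupper k i h]
    · subst h; simp
    · simp [h, h.ne']
  have hA2 := hcol k
  have hB2 := hrow k
  rw [hA1] at hA2
  rw [hB1] at hB2
  have hA0 : 0 < A := by linarith
  have hB0 : 0 < B := by linarith
  set u : Fin c → ℝ := fun i => (if i < k then M i k else 0) / A - if i = k then 1 else 0 with hu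
  set v : Fin c → ℝ := fun i => (if k < i then M k i else 0) / B - if i = k then 1 else 0 with hv
  have hus : ∑ i, u i = 0 := by
    simp only [hu, Finset.sum_sub_distrib, ← Finset.sum_div, ← hA]
    simp [hA0.ne']
  have hvs : ∑ i, v i = 0 := by
    simp only [hv, Finset.sum_sub_distrib, ← Finset.sum_div, ← hB]
    simp [hB0.ne']
  have u1 : ∀ i, i < k → u i = M i k / A := fun i h => by simp [hu, h, h.ne]
  have u2 : u k = -1 := by simp [hu]
  have u3 : ∀ i, k < i → u i = 0 := fun i h => by simp [hu, h.not_gt, h.ne']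
  have v1 : ∀ i, k < i → v i = M k i / B := fun i h => by simp [hv, h, h.ne']
  have v2 : v k = -1 := by simp [hv]
  have v3 : ∀ i, i < k → v i = 0 := fun i h => by simp [hv, h.not_gt, h.ne]
  clear_value u v A B
  refine ⟨fun i j => M i j - M k k * (u i * v j), ?_, ?_, ?_, ?_, ?_, ?_⟩
  · intro i j h
    simp only [hupper i j h]
    rcases lt_or_ge k i with h1 | h1
    · simp [u3 i h1]
    · simp [v3 j (h.trans_le h1)]
  · intro i j h
    simp only
    have hM := hstrict i j h
    rcases lt_trichotomy i k with h1 | h1 | h1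
    · rcases lt_trichotomy j k with h2 | h2 | h2
      · simpa [v3 j h2] using hM
      · subst h2
        rw [u1 i h1, v2]
        have : M i j - M j j * (M i j / A * -1) = M i j * (A + M j j) / A := by
          field_simp
          try ring
        rw [this]
        positivity
      · rw [u1 i h1, v1 j h2]
        have := hstrict i k h1
        have := hstrict k j h2
        have h5 : 0 ≤ M i k / A * (M k j / B) := by positivity
        nlinarith
    · subst h1
      rw [v1 j h, u2]
      have : M i j - M i i * (-1 * (M i j / B)) = M i j * (B + M i i) / B := by
        field_simp
        try ring
      rw [this]
      positivity
    · simpa [u3 i h1] using hM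
  · intro i
    simp [Finset.sum_sub_distrib, ← Finset.mul_sum, hvs]
  · intro j
    simp [Finset.sum_sub_distrib, ← Finset.mul_sum, ← Finset.sum_mul, hus]
  · simp [u2, v2]
  · intro i h
    rcases lt_or_gt_of_ne h with h | h
    · simp [v3 i h]
    · simp [u3 i h]

/-- An upper triangular matrix with nonnegative strictly upper entries and nonnegative
row and column sums can be modified, keeping the marginals and upper triangularity,
to have all entries nonnegative. -/
theorem stmt_5 (c : ℕ) (hc : 1 ≤ c) (M : Matrix (Fin c) (Fin c) ℝ)
    (hupper : ∀ i j : Fin c, j < i → M i j = 0)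
    (hstrict : ∀ i j : Fin c, i < j → 0 ≤ M i j)
    (hrow : ∀ i, 0 ≤ (M *ᵥ (fun _ => 1)) i)
    (hcol : ∀ j, 0 ≤ (Mᵀ *ᵥ (fun _ => 1)) j) :
    ∃ M₁ : Matrix (Fin c) (Fin c) ℝ,
      (∀ i j : Fin c, j < i → M₁ i j = 0) ∧
      M₁ *ᵥ (fun _ => 1) = M *ᵥ (fun _ => 1) ∧
      M₁ᵀ *ᵥ (fun _ => 1) = Mᵀ *ᵥ (fun _ => 1) ∧
      (∀ i j, 0 ≤ M₁ i j) := by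
  simp only [Matrix.mulVec, dotProduct, mul_one, Matrix.transpose_apply, funext_iff] at *
  have key : ∀ s : Finset (Fin c), ∃ N : Matrix (Fin c) (Fin c) ℝ,
      (∀ i j : Fin c, j < i → N i j = 0) ∧ (∀ i j : Fin c, i < j → 0 ≤ N i j) ∧
      (∀ i, ∑ j, N i j = ∑ j, M i j) ∧ (∀ j, ∑ i, N i j = ∑ i, M i j) ∧
      (∀ i ∈ s, 0 ≤ N i i) := by
    intro s
    induction s using Finset.induction_on with
    | empty => exact ⟨M, hupper, hstrict, fun _ => rfl, fun _ => rfl, by simp⟩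
    | insert k s _ ih =>
      obtain ⟨N, h1, h2, h3, h4, h5⟩ := ih
      rcases le_or_gt 0 (N k k) with hk | hk
      · refine ⟨N, h1, h2, h3, h4, fun i hi => ?_⟩
        rcases Finset.mem_insert.1 hi with rfl | hi
        · exact hk
        · exact h5 i hi
      · obtain ⟨P, p1, p2, p3, p4, p5, p6⟩ := stmt_5_step N k h1 h2
          (fun i => by rw [h3]; exact hrow i) (fun i => by rw [h4]; exact hcol i) hk
        refine ⟨P, p1, p2, fun i => (p3 i).trans (h3 i), fun i => (p4 i).trans (h4 i),
          fun i hi => ?_⟩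
        by_cases hik : i = k
        · rw [hik, p5]
        · rw [p6 i hik]
          exact h5 i ((Finset.mem_insert.1 hi).resolve_left hik)
  obtain ⟨N, h1, h2, h3, h4, h5⟩ := key Finset.univ
  refine ⟨N, h1, h3, h4, fun i j => ?_⟩
  rcases lt_trichotomy i j with h | h | h
  · exact h2 i j h
  · rw [h]; exact h5 j (Finset.mem_univ _)
  · rw [h1 i j h]
end

section
/- Let M ∈ ℝ^{c×c} be upper triangular (M_{ij} = 0 for i > j) and define y = Q (M − Mᵀ) 𝟙 ∈ ℝ^c. Then for every r ∈ {1,…,c−1} the entry y_r equals Σ_{k=r+1}^{c} (M_{1,k} + M_{2,k} + ⋯ + M_{r,k}), and y_c = 0. -/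
open Matrix Finset

/-- The matrix `Q` with `1` on and below the diagonal and `0` above. -/
def matQ (c : ℕ) : Matrix (Fin c) (Fin c) ℝ :=
  fun i j => if j ≤ i then 1 else 0

/-- For upper triangular `M` and `y = Q (M - Mᵀ) 𝟙`, each entry `y_r` (for `r = 1, …, c-1`,
here `0`-indexed with `(r : ℕ) + 1 < c`) equals `∑_{k > r} ∑_{l ≤ r} M l k`,
and the last entry `y_c` vanishes. -/
theorem stmt_6 (c : ℕ) (hc : 1 ≤ c) (M : Matrix (Fin c) (Fin c) ℝ)
    (hupper : ∀ i j : Fin c, j < i → M i j = 0) :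
    let y : Fin c → ℝ := (matQ c) *ᵥ ((M - Mᵀ) *ᵥ (fun _ => 1))
    (∀ r : Fin c, (r : ℕ) + 1 < c →
        y r = ∑ k ∈ univ.filter (fun k : Fin c => r < k),
                ∑ l ∈ univ.filter (fun l : Fin c => l ≤ r), M l k) ∧
    y ⟨c - 1, by omega⟩ = 0 := by
  intro y
  have key : ∀ r : Fin c, y r = ∑ k ∈ univ.filter (fun k : Fin c => r < k),
                ∑ l ∈ univ.filter (fun l : Fin c => l ≤ r), M l k := by
    intro r
    have h1 : y r = ∑ l ∈ univ.filter (fun l : Fin c => l ≤ r), ∑ k, (M l k - M k l) := by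
      simp only [y, mulVec, dotProduct, matQ, Matrix.sub_apply, Matrix.transpose_apply, mul_one,
        ite_mul, one_mul, zero_mul]
      rw [Finset.sum_filter]
    have h2 : ∀ l ∈ univ.filter (fun l : Fin c => l ≤ r), ∑ k, (M l k - M k l)
        = ∑ k ∈ univ.filter (fun k : Fin c => k ≤ r), (M l k - M k l)
          + ∑ k ∈ univ.filter (fun k : Fin c => r < k), M l k := by
      intro l hl
      have hl' : l ≤ r := (Finset.mem_filter.mp hl).2
      rw [← Finset.sum_filter_add_sum_filter_not univ (fun k : Fin c => k ≤ r)]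
      congr 1
      simp only [not_le]
      refine Finset.sum_congr rfl fun k hk => ?_
      have hk' : r < k := (Finset.mem_filter.mp hk).2
      rw [hupper k l (lt_of_le_of_lt hl' hk'), sub_zero]
    rw [h1, Finset.sum_congr rfl h2, Finset.sum_add_distrib]
    simp only [Finset.sum_sub_distrib]
    rw [Finset.sum_comm (f := fun l k => M k l), sub_self, zero_add, Finset.sum_comm]
  refine ⟨fun r _ => key r, ?_⟩
  rw [key]
  refine Finset.sum_eq_zero fun k hk => ?_
  have hk' := (Finset.mem_filter.mp hk).2
  have h3 := k.isLt
  rw [Fin.lt_def] at hk'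
  simp only at hk'
  omega
end

section
/- Let M ∈ ℝ^{c×c} have all entries nonnegative and satisfy M_{ij} = 0 for all i > j (upper triangular), and suppose M𝟙 = w_i and Mᵀ𝟙 = w_j for vectors w_i, w_j ∈ ℝ^c. Then all entries of Q(w_i − w_j) are nonnegative; equivalently, w_j − w_i ∈ K. -/
open Matrix

theorem matB_mul_matQ (c : ℕ) : matB c * matQ c = -1 := by
  ext i j
  have hB : ∀ k, matB c i k = -(if i = k then 1 else 0) +
      (if (i : ℕ) = (k : ℕ) + 1 then 1 else 0) := by
    intro k
    unfold matB
    by_cases h : i = k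
    · subst h; simp
    · simp [h]
  simp only [Matrix.mul_apply, hB, add_mul, Finset.sum_add_distrib, neg_mul,
    Finset.sum_neg_distrib, ite_mul, one_mul, zero_mul, Finset.sum_ite_eq, Finset.mem_univ,
    if_true]
  by_cases hi : (i : ℕ) = 0
  · rw [Finset.sum_eq_zero (fun k _ => by rw [if_neg]; omega)]
    simp only [matQ, Matrix.neg_apply, Matrix.one_apply, Fin.le_def, Fin.ext_iff]
    split_ifs <;> first | omega | norm_num
  · have hlt : (i : ℕ) - 1 < c := by omega
    rw [Finset.sum_eq_single (⟨(i : ℕ) - 1, hlt⟩ : Fin c)]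
    · rw [if_pos (by simp only; omega)]
      simp only [matQ, Matrix.neg_apply, Matrix.one_apply, Fin.le_def, Fin.ext_iff]
      split_ifs <;> first | omega | norm_num
    · intro b _ hb
      rw [if_neg]
      intro h
      apply hb
      ext
      simp only
      omega
    · simp

/-- If a nonnegative upper triangular matrix has marginals `w_i` and `w_j`, then all
entries of `Q(w_i - w_j)` are nonnegative; equivalently, `w_j - w_i ∈ K`. -/
theorem stmt_7 (c : ℕ) (hc : 1 ≤ c) (M : Matrix (Fin c) (Fin c) ℝ)
    (wi wj : Fin c → ℝ)
    (hnn : ∀ i j, 0 ≤ M i j)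
    (hupper : ∀ i j : Fin c, j < i → M i j = 0)
    (hrow : M *ᵥ (fun _ => 1) = wi)
    (hcol : Mᵀ *ᵥ (fun _ => 1) = wj) :
    (∀ k, 0 ≤ ((matQ c) *ᵥ (wi - wj)) k) ∧ wj - wi ∈ coneK c := by
  have h1 : ∀ k, 0 ≤ ((matQ c) *ᵥ (wi - wj)) k := by
    intro k
    have e : ((matQ c) *ᵥ (wi - wj)) k = ∑ i, ∑ j, (matQ c k i - matQ c k j) * M i j := by
      subst hrow hcol
      simp only [Matrix.mulVec, dotProduct, Pi.sub_apply, mul_one, Matrix.transpose_apply,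
        mul_sub, sub_mul, Finset.sum_sub_distrib, Finset.mul_sum]
      congr 1
      exact Finset.sum_comm
    rw [e]
    refine Finset.sum_nonneg fun i _ => Finset.sum_nonneg fun j _ => ?_
    by_cases h : j < i
    · simp [hupper i j h]
    · refine mul_nonneg ?_ (hnn i j)
      simp only [matQ, Fin.le_def]
      rw [Fin.lt_def] at h
      split_ifs <;> first | omega | norm_num
  refine ⟨h1, (matQ c) *ᵥ (wi - wj), h1, ?_⟩
  rw [Matrix.mulVec_mulVec, matB_mul_matQ, Matrix.neg_mulVec, Matrix.one_mulVec, neg_sub]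
end

section
/- Let c ≥ 2, let (w_i, w_j) ∈ Δ_c × Δ_c be ordered (all entries of Q_c(w_i − w_j) nonnegative), and define w̃_i = C(w_i), w̃_j = C(w_j) where C(w) = (w_2, …, w_c) + (w_1/(c−1)) 𝟙_{c−1}. Suppose M̃ ∈ ℝ^{(c−1)×(c−1)} is upper triangular, has all entries nonnegative, and satisfies M̃𝟙_{c−1} = w̃_i and M̃ᵀ𝟙_{c−1} = w̃_j. Then the block matrix M⁰ ∈ ℝ^{c×c} with (1,1)-entry (w_j)_1, first row tail sᵀ where s = ((w_i)_1 − (w_j)_1)/(c−1) · 𝟙_{c−1}, zero first column below the diagonal, and lower-right block M̃ − ((w_i)_1/(c−1)) I, is upper triangular, has nonnegative strictly upper triangular entries, and satisfies M⁰𝟙_c = w_i and (M⁰)ᵀ𝟙_c = w_j. -/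
open Matrix

/-- Inductive step: given an ordered pair `(w_i, w_j) ∈ Δ_c × Δ_c` and a nonnegative upper
triangular transport plan `M̃` for the reduced pair `(C(w_i), C(w_j)) ∈ Δ_{c-1} × Δ_{c-1}`,
the block matrix `M⁰` is upper triangular, has nonnegative strictly upper triangular
entries, and has marginals `w_i` and `w_j`. -/
theorem stmt_11 (c : ℕ) (hc : 2 ≤ c) (wi wj : Fin c → ℝ)
    (hwi : wi ∈ stdSimplex ℝ (Fin c)) (hwj : wj ∈ stdSimplex ℝ (Fin c))
    (hord : ∀ k, 0 ≤ ((matQ c) *ᵥ (wi - wj)) k)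
    (M' : Matrix (Fin (c - 1)) (Fin (c - 1)) ℝ)
    (hM'upper : ∀ i j : Fin (c - 1), j < i → M' i j = 0)
    (hM'nn : ∀ i j, 0 ≤ M' i j)
    (hM'row : M' *ᵥ (fun _ => 1) = fun k : Fin (c - 1) =>
      wi ⟨(k : ℕ) + 1, by have := k.isLt; omega⟩ + wi ⟨0, by omega⟩ / ((c : ℝ) - 1))
    (hM'col : M'ᵀ *ᵥ (fun _ => 1) = fun k : Fin (c - 1) =>
      wj ⟨(k : ℕ) + 1, by have := k.isLt; omega⟩ + wj ⟨0, by omega⟩ / ((c : ℝ) - 1)) :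
    let M0 : Matrix (Fin c) (Fin c) ℝ := fun i j =>
      if (i : ℕ) = 0 then
        (if (j : ℕ) = 0 then wj ⟨0, by omega⟩
         else (wi ⟨0, by omega⟩ - wj ⟨0, by omega⟩) / ((c : ℝ) - 1))
      else if hj : (j : ℕ) = 0 then 0
      else
        (if hi : (i : ℕ) = 0 then 0
         else M' ⟨(i : ℕ) - 1, by have := i.isLt; omega⟩ ⟨(j : ℕ) - 1, by have := j.isLt; omega⟩
                - (if i = j then wi ⟨0, by omega⟩ / ((c : ℝ) - 1) else 0))
    (∀ i j : Fin c, j < i → M0 i j = 0) ∧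
    (∀ i j : Fin c, i < j → 0 ≤ M0 i j) ∧
    M0 *ᵥ (fun _ => 1) = wi ∧ M0ᵀ *ᵥ (fun _ => 1) = wj := by
  obtain ⟨n, rfl⟩ : ∃ n, c = n + 1 := ⟨c - 1, by omega⟩
  intro M0
  have hn : (0 : ℝ) < n := by
    have : 0 < n := by omega
    exact_mod_cast this
  have hcn : ((n + 1 : ℕ) : ℝ) - 1 = n := by push_cast; ring
  have h0 : wj 0 ≤ wi 0 := by
    have h := hord 0
    simp only [Matrix.mulVec, dotProduct, matQ, Fin.le_zero_iff, ite_mul, one_mul, zero_mul,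
      Finset.sum_ite_eq', Finset.sum_ite_eq, Finset.mem_univ, if_true, Pi.sub_apply] at h
    linarith
  have e00 : M0 0 0 = wj 0 := by simp [M0]
  have e0s : ∀ j : Fin n, M0 0 j.succ = (wi 0 - wj 0) / n := by
    intro j; simp [M0]
  have es0 : ∀ i : Fin n, M0 i.succ 0 = 0 := by
    intro i; simp [M0]
  have ess : ∀ i j : Fin n, M0 i.succ j.succ = M' i j - (if i = j then wi 0 / n else 0) := by
    intro i j; simp [M0]
  have hrow : ∀ k : Fin n, ∑ j : Fin n, M' k j = wi k.succ + wi 0 / n := by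
    intro k
    have h := congrFun hM'row k
    simp only [hcn, Matrix.mulVec, dotProduct, mul_one] at h
    exact h
  have hcol : ∀ k : Fin n, ∑ j : Fin n, M' j k = wj k.succ + wj 0 / n := by
    intro k
    have h := congrFun hM'col k
    simp only [hcn, Matrix.mulVec, dotProduct, mul_one, Matrix.transpose_apply] at h
    exact h
  clear_value M0
  refine ⟨?_, ?_, ?_, ?_⟩
  · intro i j hij
    induction i using Fin.cases with
    | zero => simp at hij
    | succ i =>
      induction j using Fin.cases with
      | zero => exact es0 i
      | succ j =>
        have hij' : j < i := by simpa using hij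
        have h : M' i j = 0 := hM'upper i j hij'
        rw [ess, h, if_neg hij'.ne', sub_zero]
  · intro i j hij
    induction j using Fin.cases with
    | zero => simp at hij
    | succ j =>
      induction i using Fin.cases with
      | zero =>
        rw [e0s]
        exact div_nonneg (sub_nonneg.2 h0) hn.le
      | succ i =>
        have hij' : i < j := by simpa using hij
        rw [ess, if_neg hij'.ne, sub_zero]
        exact hM'nn i j
  · funext i
    simp only [Matrix.mulVec, dotProduct, mul_one]
    rw [Fin.sum_univ_succ]
    induction i using Fin.cases with
    | zero =>
      simp only [e00, e0s, Finset.sum_const, Finset.card_univ, Fintype.card_fin, nsmul_eq_mul]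
      field_simp
      ring
    | succ i =>
      simp only [es0, ess, Finset.sum_sub_distrib]
      rw [hrow, Finset.sum_ite_eq, if_pos (Finset.mem_univ _)]
      ring
  · funext j
    simp only [Matrix.mulVec, dotProduct, mul_one, Matrix.transpose_apply]
    rw [Fin.sum_univ_succ]
    induction j using Fin.cases with
    | zero => simp [e00, es0]
    | succ j =>
      simp only [e0s, ess, Finset.sum_sub_distrib]
      rw [hcol, Finset.sum_ite_eq', if_pos (Finset.mem_univ _)]
      ring
end

section
/- Let (w_i, w_j) ∈ Δ_c × Δ_c be ordered, i.e. w_j − w_i ∈ K. Then there exists a matrix M ∈ ℝ^{c×c} with all entries nonnegative, satisfying M𝟙 = w_i and Mᵀ𝟙 = w_j, and ⟨Q − I, M⟩ = 0 (i.e. M is upper triangular). -/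
open Matrix

theorem aux_matB (c : ℕ) (y : Fin c → ℝ) (Y : ℕ → ℝ) (hY : ∀ k : Fin c, Y k = y k) (k : Fin c) :
    (matB c *ᵥ y) k = (if (k : ℕ) = 0 then 0 else Y ((k : ℕ) - 1)) - Y k := by
  have h1 : ∀ j : Fin c, matB c k j * y j
      = (if (k : ℕ) = (j : ℕ) + 1 then y j else 0) - (if k = j then y j else 0) := by
    intro j
    unfold matB
    by_cases h : k = j
    · subst h; simp
    · by_cases h2 : (k : ℕ) = (j : ℕ) + 1 <;> simp [h, h2]
  simp only [mulVec, dotProduct, h1, Finset.sum_sub_distrib]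
  congr 1
  · by_cases hk : (k : ℕ) = 0
    · rw [if_pos hk]
      apply Finset.sum_eq_zero
      intro j _
      rw [if_neg (by omega)]
    · rw [if_neg hk]
      have hlt : (k : ℕ) - 1 < c := by have := k.2; omega
      rw [Finset.sum_eq_single (⟨(k : ℕ) - 1, hlt⟩ : Fin c)]
      · rw [if_pos (by simp; omega), ← hY]
      · intro b _ hb
        rw [if_neg]
        intro h
        apply hb
        ext
        simp; omega
      · simp
  · rw [hY]; simp

theorem aux_super (a b p q : ℝ) (h1 : a ≤ b) (h2 : p ≤ q) :
    0 ≤ min b q - min a q - (min b p - min a p) := by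
  rcases min_cases b q with h | h <;> rcases min_cases a q with h' | h' <;>
  rcases min_cases b p with h3 | h3 <;> rcases min_cases a p with h4 | h4 <;> linarith

/-- For an ordered pair `(w_i, w_j) ∈ Δ_c × Δ_c` there exists a nonnegative coupling `M`
with marginals `w_i`, `w_j` satisfying `⟨Q - I, M⟩ = 0`. -/
theorem stmt_12 (c : ℕ) (hc : 1 ≤ c) (wi wj : Fin c → ℝ)
    (hwi : wi ∈ stdSimplex ℝ (Fin c)) (hwj : wj ∈ stdSimplex ℝ (Fin c))
    (hord : wj - wi ∈ coneK c) :
    ∃ M : Matrix (Fin c) (Fin c) ℝ,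
      (∀ i j, 0 ≤ M i j) ∧
      M *ᵥ (fun _ => 1) = wi ∧ Mᵀ *ᵥ (fun _ => 1) = wj ∧
      (∑ i, ∑ j, (matQ c - 1) i j * M i j) = 0 := by
  obtain ⟨y, hy, hyw⟩ := hord
  obtain ⟨hwi0, hwi1⟩ := hwi
  obtain ⟨hwj0, hwj1⟩ := hwj
  let f : ℕ → ℝ := fun n => if h : n < c then wi ⟨n, h⟩ else 0
  let g : ℕ → ℝ := fun n => if h : n < c then wj ⟨n, h⟩ else 0
  let Y : ℕ → ℝ := fun n => if h : n < c then y ⟨n, h⟩ else 0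
  have hf : ∀ k : Fin c, f k = wi k := fun k => by simp [f]
  have hg : ∀ k : Fin c, g k = wj k := fun k => by simp [g]
  have hY : ∀ k : Fin c, Y k = y k := fun k => by simp [Y]
  have hf0 : ∀ n, 0 ≤ f n := by
    intro n; by_cases h : n < c
    · simpa [f, h] using hwi0 ⟨n, h⟩
    · simp [f, h]
  have hg0 : ∀ n, 0 ≤ g n := by
    intro n; by_cases h : n < c
    · simpa [g, h] using hwj0 ⟨n, h⟩
    · simp [g, h]
  let F : ℕ → ℝ := fun k => ∑ n ∈ Finset.range k, f n
  let G : ℕ → ℝ := fun k => ∑ n ∈ Finset.range k, g n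
  have hFs : ∀ k, F (k + 1) = F k + f k := fun k => Finset.sum_range_succ _ _
  have hGs : ∀ k, G (k + 1) = G k + g k := fun k => Finset.sum_range_succ _ _
  have hF0 : F 0 = 0 := by simp [F]
  have hG0 : G 0 = 0 := by simp [G]
  have hFm : Monotone F := monotone_nat_of_le_succ fun n => by linarith [hFs n, hf0 n]
  have hGm : Monotone G := monotone_nat_of_le_succ fun n => by linarith [hGs n, hg0 n]
  have hFc : F c = 1 := by
    rw [← hwi1]; simp only [F]; rw [Finset.sum_range]
    exact Finset.sum_congr rfl fun k _ => hf k
  have hGc : G c = 1 := by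
    rw [← hwj1]; simp only [G]; rw [Finset.sum_range]
    exact Finset.sum_congr rfl fun k _ => hg k
  have key : ∀ k, k < c → G (k + 1) - F (k + 1) = - Y k := by
    intro k
    have hd : ∀ k, k < c → g k - f k = (if k = 0 then 0 else Y (k - 1)) - Y k := by
      intro k hk
      have := congrFun hyw ⟨k, hk⟩
      rw [aux_matB c y Y hY] at this
      simp only [Pi.sub_apply] at this
      rw [← this, ← hf, ← hg]
    induction k with
    | zero =>
      intro hk
      have := hd 0 hk
      simp only [if_true] at this
      rw [hGs, hFs, hF0, hG0]; linarith
    | succ k ih =>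
      intro hk
      have h1 := hd (k + 1) hk
      have h2 := ih (by omega)
      simp at h1
      rw [hGs (k + 1), hFs (k + 1)]; linarith
  have hGF : ∀ k, k < c → G (k + 1) ≤ F (k + 1) := by
    intro k hk
    have h1 := key k hk
    have h2 : 0 ≤ Y k := by rw [hY ⟨k, hk⟩]; exact hy _
    linarith
  have hFnn : ∀ k, 0 ≤ F k := fun k => hF0 ▸ hFm (Nat.zero_le k)
  have hGnn : ∀ k, 0 ≤ G k := fun k => hG0 ▸ hGm (Nat.zero_le k)
  have hFle : ∀ k, k ≤ c → F k ≤ 1 := fun k hk => hFc ▸ hFm hk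
  have hGle : ∀ k, k ≤ c → G k ≤ 1 := fun k hk => hGc ▸ hGm hk
  refine ⟨fun i j => min (F (i + 1)) (G (j + 1)) - min (F i) (G (j + 1))
    - (min (F (i + 1)) (G j) - min (F i) (G j)), ?_, ?_, ?_, ?_⟩
  · intro i j
    exact aux_super _ _ _ _ (hFm (Nat.le_succ _)) (hGm (Nat.le_succ _))
  · funext i
    simp only [mulVec, dotProduct, mul_one]
    have := Finset.sum_range_sub (fun j : ℕ => min (F (i + 1)) (G j) - min (F i) (G j)) c
    rw [Finset.sum_range] at this
    refine this.trans ?_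
    rw [hG0, hGc, min_eq_left (hFle _ i.2), min_eq_left (hFle _ i.2.le),
      min_eq_right (hFnn _), min_eq_right (hFnn _), hFs, hf]
    ring
  · funext j
    simp only [mulVec, dotProduct, mul_one, transpose_apply]
    have := Finset.sum_range_sub (fun i : ℕ => min (F i) (G (j + 1)) - min (F i) (G j)) c
    rw [Finset.sum_range] at this
    refine (Finset.sum_congr rfl fun i _ => ?_).trans (this.trans ?_)
    · exact sub_sub_sub_comm _ _ _ _
    rw [hF0, hFc, min_eq_right (hGle _ j.2), min_eq_right (hGle _ j.2.le),
      min_eq_left (hGnn _), min_eq_left (hGnn _), hGs, hg]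
    ring
  · apply Finset.sum_eq_zero
    intro i _
    apply Finset.sum_eq_zero
    intro j _
    rcases lt_trichotomy i j with h | h | h
    · have : (matQ c - 1) i j = 0 := by
        simp [matQ, Matrix.sub_apply, Matrix.one_apply, h.ne, not_le.mpr h]
      rw [this, zero_mul]
    · have : (matQ c - 1) i j = 0 := by
        simp [matQ, Matrix.sub_apply, h]
      rw [this, zero_mul]
    · have h1 : G (j + 1) ≤ F i := (hGF j j.2).trans (hFm (Nat.succ_le_of_lt h))
      have h2 : F i ≤ F (i + 1) := hFm (Nat.le_succ _)
      have h3 : G j ≤ G (j + 1) := hGm (Nat.le_succ _)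
      have h4 : min (F (i + 1)) (G (j + 1)) - min (F i) (G (j + 1))
          - (min (F (i + 1)) (G j) - min (F i) (G j)) = 0 := by
        rw [min_eq_right (h1.trans h2), min_eq_right h1, min_eq_right (h3.trans (h1.trans h2)),
          min_eq_right (h3.trans h1)]
        ring
      exact mul_eq_zero_of_right _ h4
end

section
/- A pair (w_i, w_j) ∈ Δ_c × Δ_c is ordered (i.e. w_j − w_i ∈ K) if and only if the set Π(w_i, w_j) ∩ {M ∈ ℝ^{c×c} : ⟨Q − I, M⟩ = 0} is nonempty; that is, if and only if there exists a coupling M with nonnegative entries, row marginal w_i, column marginal w_j, and ⟨Q − I, M⟩ = 0. -/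
open Matrix

/-- Cumulative sums. -/
noncomputable def cumF {c : ℕ} (w : Fin c → ℝ) (n : ℕ) : ℝ :=
  ∑ k : Fin c, if (k : ℕ) < n then w k else 0

/-- Shifted extension of a vector to the naturals. -/
noncomputable def shiftY {c : ℕ} (y : Fin c → ℝ) (n : ℕ) : ℝ :=
  ∑ k : Fin c, if (k : ℕ) + 1 = n then y k else 0

lemma cumF_zero {c : ℕ} (w : Fin c → ℝ) : cumF w 0 = 0 := by simp [cumF]

lemma cumF_top {c : ℕ} (w : Fin c → ℝ) : cumF w c = ∑ k, w k := by simp [cumF]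

lemma cumF_succ {c : ℕ} (w : Fin c → ℝ) (i : Fin c) :
    cumF w ((i : ℕ) + 1) = cumF w i + w i := by
  have h : w i = ∑ k : Fin c, if k = i then w k else 0 := by simp
  rw [h]
  unfold cumF
  rw [← Finset.sum_add_distrib]
  refine Finset.sum_congr rfl fun k _ => ?_
  by_cases hk : k = i
  · subst hk; simp
  · have hk2 : (k : ℕ) ≠ i := fun h => hk (Fin.ext h)
    have : (k : ℕ) < i + 1 ↔ (k : ℕ) < i := by omega
    simp [hk, this]

lemma cumF_mono {c : ℕ} (w : Fin c → ℝ) (hw : ∀ k, 0 ≤ w k) : Monotone (cumF w) := by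
  intro a b hab
  refine Finset.sum_le_sum fun k _ => ?_
  have := hw k
  split_ifs <;> linarith

lemma shiftY_zero {c : ℕ} (y : Fin c → ℝ) : shiftY y 0 = 0 := by simp [shiftY]

lemma shiftY_succ {c : ℕ} (y : Fin c → ℝ) (i : Fin c) : shiftY y ((i : ℕ) + 1) = y i := by
  simp [shiftY, Fin.val_inj]

lemma shiftY_nonneg {c : ℕ} (y : Fin c → ℝ) (hy : ∀ k, 0 ≤ y k) (n : ℕ) : 0 ≤ shiftY y n := by
  refine Finset.sum_nonneg fun k _ => ?_
  have := hy k
  split_ifs <;> linarith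

lemma matB_mulVec {c : ℕ} (y : Fin c → ℝ) (i : Fin c) :
    (matB c *ᵥ y) i = shiftY y i - shiftY y ((i : ℕ) + 1) := by
  simp only [Matrix.mulVec, dotProduct, shiftY, ← Finset.sum_sub_distrib]
  refine Finset.sum_congr rfl fun j _ => ?_
  simp only [matB, Fin.ext_iff]
  split_ifs <;> first | omega | ring

lemma coneK_iff {c : ℕ} (a b : Fin c → ℝ) :
    b - a ∈ coneK c ↔ ∀ n ≤ c, cumF b n ≤ cumF a n := by
  constructor
  · rintro ⟨y, hy, h⟩ n hn
    have key : ∀ n ≤ c, cumF a n - cumF b n = shiftY y n := by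
      intro n
      induction n with
      | zero => intro _; simp [cumF_zero, shiftY_zero]
      | succ n ih =>
        intro hn
        have h1 := ih (by omega)
        have h2 := congrFun h ⟨n, hn⟩
        rw [matB_mulVec] at h2
        have h3 := cumF_succ a ⟨n, hn⟩
        have h4 := cumF_succ b ⟨n, hn⟩
        simp only [Pi.sub_apply] at h2 h3 h4
        linarith
    have := key n hn
    have := shiftY_nonneg y hy n
    linarith
  · intro h
    refine ⟨fun k => cumF a ((k : ℕ) + 1) - cumF b ((k : ℕ) + 1),
      fun k => sub_nonneg.2 (h _ k.2), ?_⟩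
    have key : ∀ n ≤ c, shiftY (fun k : Fin c => cumF a ((k : ℕ) + 1) - cumF b ((k : ℕ) + 1)) n
        = cumF a n - cumF b n := by
      intro n hn
      cases n with
      | zero => simp [cumF_zero, shiftY_zero]
      | succ n => exact shiftY_succ _ (⟨n, hn⟩ : Fin c)
    funext i
    rw [matB_mulVec, key _ i.2.le, key _ i.2, cumF_succ, cumF_succ, Pi.sub_apply]
    ring

lemma tri_iff {c : ℕ} (M : Matrix (Fin c) (Fin c) ℝ) (hM : ∀ i j, 0 ≤ M i j) :
    (∑ i, ∑ j, (matQ c - 1) i j * M i j) = 0 ↔ ∀ i j, j < i → M i j = 0 := by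
  have hcoef : ∀ i j, (matQ c - 1) i j = if j < i then (1 : ℝ) else 0 := by
    intro i j
    simp only [matQ, Matrix.sub_apply, Matrix.one_apply]
    rcases lt_trichotomy i j with h | h | h
    · simp [h.not_ge, h.ne, h.le]
    · simp [h]
    · simp [h.le, h.ne', h]
  have hnn : ∀ i j, 0 ≤ (matQ c - 1) i j * M i j := by
    intro i j
    rw [hcoef]
    have := hM i j
    split_ifs <;> simp [this]
  rw [Finset.sum_eq_zero_iff_of_nonneg (fun i _ => Finset.sum_nonneg fun j _ => hnn i j)]
  constructor
  · intro h i j hij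
    have h1 := (Finset.sum_eq_zero_iff_of_nonneg (fun j _ => hnn i j)).1
      (h i (Finset.mem_univ _)) j (Finset.mem_univ _)
    rw [hcoef] at h1
    simpa [hij] using h1
  · intro h i _
    refine Finset.sum_eq_zero fun j _ => ?_
    rw [hcoef]
    split_ifs with hij
    · simp [h i j hij]
    · simp

/-- A pair `(w_i, w_j) ∈ Δ_c × Δ_c` is ordered iff there exists a coupling `M` with
nonnegative entries, row marginal `w_i`, column marginal `w_j`, and `⟨Q - I, M⟩ = 0`. -/
theorem stmt_13 (c : ℕ) (hc : 1 ≤ c) (wi wj : Fin c → ℝ)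
    (hwi : wi ∈ stdSimplex ℝ (Fin c)) (hwj : wj ∈ stdSimplex ℝ (Fin c)) :
    wj - wi ∈ coneK c ↔
      ∃ M : Matrix (Fin c) (Fin c) ℝ,
        (∀ i j, 0 ≤ M i j) ∧
        M *ᵥ (fun _ => 1) = wi ∧ Mᵀ *ᵥ (fun _ => 1) = wj ∧
        (∑ i, ∑ j, (matQ c - 1) i j * M i j) = 0 := by
  rw [coneK_iff]
  constructor
  · intro h
    have hF := cumF_mono wi hwi.1
    have hG := cumF_mono wj hwj.1
    have hF0 := cumF_zero wi
    have hG0 := cumF_zero wj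
    have hF1 : cumF wi c = 1 := (cumF_top wi).trans hwi.2
    have hG1 : cumF wj c = 1 := (cumF_top wj).trans hwj.2
    have hFs := cumF_succ wi
    have hGs := cumF_succ wj
    generalize cumF wi = F at *
    generalize cumF wj = G at *
    have hFn : ∀ n, 0 ≤ F n := fun n => hF0 ▸ hF (Nat.zero_le n)
    have hGn : ∀ n, 0 ≤ G n := fun n => hG0 ▸ hG (Nat.zero_le n)
    have hFl : ∀ n ≤ c, F n ≤ 1 := fun n hn => hF1 ▸ hF hn
    have hGl : ∀ n ≤ c, G n ≤ 1 := fun n hn => hG1 ▸ hG hn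
    have hnn : ∀ i j : Fin c, 0 ≤ (min (F (i + 1)) (G (j + 1)) - min (F i) (G (j + 1)))
        - (min (F (i + 1)) (G j) - min (F i) (G j)) := by
      intro i j
      have h1 := hF (Nat.le_succ i)
      have h2 := hG (Nat.le_succ j)
      simp only [Nat.succ_eq_add_one] at h1 h2
      simp only [min_def]
      split_ifs <;> linarith
    refine ⟨fun i j => (min (F (i + 1)) (G (j + 1)) - min (F i) (G (j + 1)))
        - (min (F (i + 1)) (G j) - min (F i) (G j)), hnn, ?_, ?_, ?_⟩
    · funext i
      simp only [Matrix.mulVec, dotProduct, mul_one]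
      rw [Fin.sum_univ_eq_sum_range (fun j => (min (F (i + 1)) (G (j + 1)) - min (F i) (G (j + 1)))
        - (min (F (i + 1)) (G j) - min (F i) (G j))) c,
        Finset.sum_range_sub (fun j => min (F (i + 1)) (G j) - min (F i) (G j)) c,
        hG1, hG0, min_eq_left (hFl _ i.2), min_eq_left (hFl _ i.2.le), min_eq_right (hFn _),
        min_eq_right (hFn _), hFs]
      ring
    · funext j
      simp only [Matrix.mulVec, dotProduct, mul_one]
      show ∑ i : Fin c, ((min (F (i + 1)) (G (j + 1)) - min (F i) (G (j + 1)))
        - (min (F (i + 1)) (G j) - min (F i) (G j))) = wj j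
      have : ∀ i : ℕ, (min (F (i + 1)) (G (j + 1)) - min (F i) (G (j + 1)))
        - (min (F (i + 1)) (G j) - min (F i) (G j)) =
        (min (F (i + 1)) (G (j + 1)) - min (F (i + 1)) (G j))
        - (min (F i) (G (j + 1)) - min (F i) (G j)) := by intro i; ring
      simp only [this]
      rw [Fin.sum_univ_eq_sum_range (fun i => (min (F (i + 1)) (G (j + 1)) - min (F (i + 1)) (G j))
        - (min (F i) (G (j + 1)) - min (F i) (G j))) c,
        Finset.sum_range_sub (fun i => min (F i) (G (j + 1)) - min (F i) (G j)) c,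
        hF1, hF0, min_eq_right (hGl _ j.2), min_eq_right (hGl _ j.2.le), min_eq_left (hGn _),
        min_eq_left (hGn _), hGs]
      ring
    · refine (tri_iff _ hnn).2 fun i j hij => ?_
      have h0 : (j : ℕ) + 1 ≤ i := hij
      have h1 : G (j + 1) ≤ F i := (h _ j.2).trans (hF h0)
      have h2 : G j ≤ G (j + 1) := hG (Nat.le_succ _)
      have h3 : F i ≤ F (i + 1) := hF (Nat.le_succ _)
      show (min (F (i + 1)) (G (j + 1)) - min (F i) (G (j + 1)))
        - (min (F (i + 1)) (G j) - min (F i) (G j)) = 0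
      rw [min_eq_right h1, min_eq_right (h1.trans h3), min_eq_right (h2.trans h1),
        min_eq_right (h2.trans (h1.trans h3))]
      ring
  · rintro ⟨M, hM, h1, h2, h3⟩ n hn
    rw [tri_iff M hM] at h3
    have e1 : cumF wi n = ∑ i : Fin c, ∑ j : Fin c, if (i : ℕ) < n then M i j else 0 := by
      unfold cumF
      refine Finset.sum_congr rfl fun i _ => ?_
      rw [← h1]
      split_ifs <;> simp [Matrix.mulVec, dotProduct]
    have e2 : cumF wj n = ∑ i : Fin c, ∑ j : Fin c, if (j : ℕ) < n then M i j else 0 := by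
      rw [Finset.sum_comm]
      unfold cumF
      refine Finset.sum_congr rfl fun i _ => ?_
      rw [← h2]
      split_ifs <;> simp [Matrix.mulVec, dotProduct]
    rw [e1, e2]
    refine Finset.sum_le_sum fun i _ => Finset.sum_le_sum fun j _ => ?_
    have := hM i j
    split_ifs with ha hb hb
    · exact le_rfl
    · exact (h3 i j (Fin.lt_def.2 (by omega))).le
    · exact this
    · exact le_rfl
end
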